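/- Let G be a C_{4k}-free bipartite graph. Then the matching number satisfies ν(G) = |Core(G)| + |Npart(G)|/2, the independence number satisfies α(G) = |Supp(G)| + |Npart(G)|/2, the nullity equals |Supp(G)| − |Core(G)|, and the rank of the adjacency matrix equals 2|Core(G)| + |Npart(G)|. -/

import Mathlib

open scoped Classical

namespace C4kPaper

open SimpleGraph

variable {V : Type*} [Fintype V] [DecidableEq V]

/-- The null space of the adjacency matrix of `G`, as a set of vectors. -/
noncomputable def nullSet (G : SimpleGraph V) : Set (V → ℝ) :=
  {x | Matrix.mulVec (G.adjMatrix ℝ) x = 0}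

/-- The null space of the adjacency matrix of `G`, as a submodule of `ℝ^V`. -/
noncomputable def nullModule (G : SimpleGraph V) : Submodule ℝ (V → ℝ) :=
  LinearMap.ker (G.adjMatrix ℝ).mulVecLin

/-- The nullity of `G`: the dimension of the null space of its adjacency matrix. -/
noncomputable def nullity (G : SimpleGraph V) : ℕ :=
  Module.finrank ℝ (nullModule G)

/-- The rank of the adjacency matrix of `G` over `ℝ`. -/
noncomputable def rk (G : SimpleGraph V) : ℕ :=
  (G.adjMatrix ℝ).rank

/-- The support of `G`: vertices where some null space vector is nonzero. -/
def supp (G : SimpleGraph V) : Set V :=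
  {v | ∃ x ∈ nullSet G, x v ≠ 0}

/-- The core of `G`: the neighbors of the support. -/
def core (G : SimpleGraph V) : Set V :=
  {u | ∃ v ∈ supp G, G.Adj u v}

/-- The N-part of `G`: vertices neither in the support nor in the core. -/
def npart (G : SimpleGraph V) : Set V :=
  (supp G ∪ core G)ᶜ

/-- `G` is bipartite. -/
def IsBipartite (G : SimpleGraph V) : Prop :=
  ∃ s : Set V, ∀ ⦃u v : V⦄, G.Adj u v → (u ∈ s ↔ v ∉ s)

/-- `G` has no cycle whose length is a multiple of 4. -/
def C4kFree (G : SimpleGraph V) : Prop :=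
  ∀ (v : V) (c : G.Walk v v), c.IsCycle → ¬ (4 ∣ c.length)

/-- `M` is a maximum matching of `G`. -/
def IsMaximumMatching (G : SimpleGraph V) (M : G.Subgraph) : Prop :=
  M.IsMatching ∧ ∀ M' : G.Subgraph, M'.IsMatching → M'.edgeSet.ncard ≤ M.edgeSet.ncard

/-- The matching number of `G`. -/
noncomputable def matchNum (G : SimpleGraph V) : ℕ :=
  sSup {n | ∃ M : G.Subgraph, M.IsMatching ∧ M.edgeSet.ncard = n}

/-- `s` is an independent set of `G`. -/
def IsIndep (G : SimpleGraph V) (s : Set V) : Prop :=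
  ∀ ⦃u⦄, u ∈ s → ∀ ⦃w⦄, w ∈ s → ¬ G.Adj u w

/-- `s` is a maximum independent set of `G`. -/
def IsMaxIndep (G : SimpleGraph V) (s : Set V) : Prop :=
  IsIndep G s ∧ ∀ t : Set V, IsIndep G t → t.ncard ≤ s.ncard

/-- The independence number of `G`. -/
noncomputable def indepNum (G : SimpleGraph V) : ℕ :=
  sSup {n | ∃ s : Set V, IsIndep G s ∧ s.ncard = n}

/-- An `(M,x)`-alternating walk `w₀, w₁, …, w_j` (here `w_i = p.getVert i`):
for all `0 ≤ i < ⌊(j-1)/2⌋`, `{w_{2i}, w_{2i+1}} ∈ M` and `x_{w_{2i}} · x_{w_{2i+2}} < 0`. -/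
def MxAltWalk (G : SimpleGraph V) (M : G.Subgraph) (x : V → ℝ) {v u : V}
    (p : G.Walk v u) : Prop :=
  ∀ i : ℕ, i < (p.length - 1) / 2 →
    M.Adj (p.getVert (2 * i)) (p.getVert (2 * i + 1)) ∧
      x (p.getVert (2 * i)) * x (p.getVert (2 * i + 2)) < 0

/-- A maximal `(M,x)`-alternating walk: one not properly contained in a longer
`(M,x)`-alternating walk from the same start. -/
def MaximalMxAltWalk (G : SimpleGraph V) (M : G.Subgraph) (x : V → ℝ) {v u : V}
    (p : G.Walk v u) : Prop :=
  MxAltWalk G M x p ∧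
    ∀ (u' : V) (q : G.Walk v u'), MxAltWalk G M x q → p.support <+: q.support →
      q.length = p.length

/-- An `M`-alternating walk starting with an edge not in `M`:
the `i`-th edge belongs to `M` iff `i` is odd. -/
def MAltWalk (G : SimpleGraph V) (M : G.Subgraph) {v u : V} (p : G.Walk v u) : Prop :=
  ∀ i : ℕ, i < p.length → (M.Adj (p.getVert i) (p.getVert (i + 1)) ↔ Odd i)

/-- Vertices reachable from `v` by an even-length `M`-alternating path. -/
def Re (G : SimpleGraph V) (M : G.Subgraph) (v : V) : Set V :=
  {u | ∃ p : G.Walk v u, p.IsPath ∧ MAltWalk G M p ∧ Even p.length}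

/-- Vertices reachable from `v` by an odd-length `M`-alternating path. -/
def Ro (G : SimpleGraph V) (M : G.Subgraph) (v : V) : Set V :=
  {u | ∃ p : G.Walk v u, p.IsPath ∧ MAltWalk G M p ∧ Odd p.length}



section AlternatingWalk

omit [Fintype V] [DecidableEq V]

variable {G : SimpleGraph V} {w : ℕ → V}

/-- The walk visiting the first `n + 1` terms of a sequence of successively adjacent vertices. -/
def walkOfSeq (hw : ∀ k, G.Adj (w k) (w (k + 1))) : ∀ n a : ℕ, G.Walk (w a) (w (a + n))
  | 0, _ => Walk.nil
  | n + 1, a => Walk.cons (hw a) ((walkOfSeq hw n (a + 1)).copy rfl (by congr 1; omega))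

lemma length_walkOfSeq (hw : ∀ k, G.Adj (w k) (w (k + 1))) (n a : ℕ) :
    (walkOfSeq hw n a).length = n := by
  induction n generalizing a with
  | zero => rfl
  | succ n ih => simp [walkOfSeq, ih]

lemma support_walkOfSeq (hw : ∀ k, G.Adj (w k) (w (k + 1))) (n a : ℕ) :
    (walkOfSeq hw n a).support = (List.range' a (n + 1)).map w := by
  induction n generalizing a with
  | zero => simp [walkOfSeq]
  | succ n ih => rw [List.range'_succ]; simp [walkOfSeq, ih]

lemma exists_isCycle_of_seq (hw : ∀ k, G.Adj (w k) (w (k + 1))) {a d : ℕ} (hd : 3 ≤ d)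
    (hclosed : w (a + d) = w a)
    (hinj : ∀ i j, a < i → i < j → j ≤ a + d → w i ≠ w j) :
    ∃ c : G.Walk (w a) (w a), c.IsCycle ∧ c.length = d := by
  obtain ⟨n, rfl⟩ : ∃ n, d = n + 1 := ⟨d - 1, by omega⟩
  let p : G.Walk (w (a + 1)) (w a) :=
    (walkOfSeq hw n (a + 1)).copy rfl (by rw [← hclosed]; congr 1; omega)
  have hlen : p.length = n := by simp [p, length_walkOfSeq]
  have hp : p.IsPath := by
    rw [Walk.isPath_def]
    simp only [p, Walk.support_copy, support_walkOfSeq]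
    refine List.Nodup.map_on ?_ List.nodup_range'
    intro i hi j hj hij
    simp only [List.mem_range'_1] at hi hj
    rcases lt_trichotomy i j with h | h | h
    · exact absurd hij (hinj i j (by omega) h (by omega))
    · exact h
    · exact absurd hij.symm (hinj j i (by omega) h (by omega))
  refine ⟨Walk.cons (hw a) p, (Walk.cons_isCycle_iff p (hw a)).2 ⟨hp, fun he => ?_⟩,
    by simp [hlen]⟩
  have := hp.length_eq_one_of_mem_edges (Sym2.eq_swap ▸ he)
  omega

/-- A sequence of successively adjacent vertices along which `f` changes sign every second step
forces a cycle of length divisible by four. -/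
lemma false_of_alternating_seq [Finite V] (hb : IsBipartite G) (hc : C4kFree G)
    (hw : ∀ k, G.Adj (w k) (w (k + 1))) (f : V → ℝ)
    (hf : ∀ k, f (w k) * f (w (k + 2)) < 0) : False := by
  obtain ⟨s, hs⟩ := hb
  have hrep : ∃ d, 0 < d ∧ ∃ a, w (a + d) = w a := by
    obtain ⟨i, j, hij, h⟩ := Finite.exists_ne_map_eq_of_infinite w
    rcases lt_or_gt_of_ne hij with hlt | hlt
    · exact ⟨j - i, by omega, i, by rw [h]; congr 1; omega⟩
    · exact ⟨i - j, by omega, j, by rw [← h]; congr 1; omega⟩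
  have hmin := fun m => Nat.find_min hrep (m := m)
  obtain ⟨hpos, a, ha⟩ := Nat.find_spec hrep
  set d := Nat.find hrep
  have hside : ∀ n, (w (a + n) ∈ s ↔ (w a ∈ s ↔ Even n)) := by
    intro n
    induction n with
    | zero => simp
    | succ n ih =>
      have := hs (hw (a + n))
      rw [Nat.even_add_one, ← add_assoc]
      tauto
  have hsign : ∀ m, 0 < (-1 : ℝ) ^ m * (f (w a) * f (w (a + 2 * m))) := by
    intro m
    induction m with
    | zero =>
      have h0 : f (w a) ≠ 0 := fun h => by simpa [h] using hf a
      simpa using mul_self_pos.2 h0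
    | succ m ih =>
      have h1 := mul_pos_of_neg_of_neg (hf (a + 2 * m)) (neg_lt_zero.2 ih)
      have h2 : 0 < f (w (a + 2 * m)) ^ 2 := by
        have h0 : f (w (a + 2 * m)) ≠ 0 := fun h => by simpa [h] using hf (a + 2 * m)
        positivity
      rw [show a + 2 * (m + 1) = a + 2 * m + 2 by ring]
      refine pos_of_mul_pos_right (a := f (w (a + 2 * m)) ^ 2) ?_ h2.le
      rw [pow_succ]
      convert h1 using 1
      ring
  have heven : Even d := by
    have := hside d
    rw [ha] at this
    tauto
  obtain ⟨m, hm⟩ := heven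
  have hmeven : Even m := by
    by_contra hodd
    have h := hsign m
    rw [show a + 2 * m = a + d by omega, ha, (Nat.not_even_iff_odd.1 hodd).neg_one_pow] at h
    nlinarith [mul_self_nonneg (f (w a))]
  obtain ⟨l, hl⟩ := hmeven
  obtain ⟨c, hcyc, hlen⟩ := exists_isCycle_of_seq hw (a := a) (d := d) (by omega) ha (by
    intro i j hi hij hj h
    exact hmin (j - i) (by omega) ⟨by omega, i, by rw [h]; congr 1; omega⟩)
  exact hc _ c hcyc ⟨l, by omega⟩

end AlternatingWalk

section NullSpace

omit [DecidableEq V]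

variable {G : SimpleGraph V}

/-- If the neighbour sums of `f` vanish wherever `f` does not, then the support of `f` is
independent. -/
lemma mul_eq_zero_of_neighbor_sum_eq_zero (hb : IsBipartite G) (hc : C4kFree G) (f : V → ℝ)
    (hf : ∀ v, f v ≠ 0 → ∑ u ∈ G.neighborFinset v, f u = 0) {u v : V} (huv : G.Adj u v) :
    f u * f v = 0 := by
  by_contra hne
  obtain ⟨hu, hv⟩ := mul_ne_zero_iff.1 hne
  let P := {p : V × V // G.Adj p.1 p.2 ∧ f p.1 ≠ 0 ∧ f p.2 ≠ 0}
  have step : ∀ p : P, ∃ z, G.Adj p.1.2 z ∧ f p.1.1 * f z < 0 := by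
    rintro ⟨⟨a, b⟩, hab, ha, hb'⟩
    have hsum : ∑ z ∈ G.neighborFinset b, f a * f z = 0 := by
      rw [← Finset.mul_sum, hf b hb', mul_zero]
    by_contra! hcon
    have := (Finset.sum_eq_zero_iff_of_nonneg
      (fun z hz => hcon z ((G.mem_neighborFinset b z).1 hz))).1 hsum a
        ((G.mem_neighborFinset b a).2 hab.symm)
    exact ha (mul_self_eq_zero.1 this)
  choose z hadj hneg using step
  let next : P → P := fun p => ⟨(p.1.2, z p), hadj p, p.2.2.2,
    fun h => by simpa [h] using hneg p⟩
  let seq : ℕ → P := fun n => next^[n] ⟨(u, v), huv, hu, hv⟩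
  have hseq : ∀ n, seq (n + 1) = next (seq n) := fun n => Function.iterate_succ_apply' _ _ _
  have h1 : ∀ n, (seq (n + 1)).1.1 = (seq n).1.2 := fun n => by rw [hseq]
  refine false_of_alternating_seq hb hc (w := fun n => (seq n).1.1) (fun n => ?_) f fun n => ?_
  · rw [h1]
    exact (seq n).2.1
  · change f (seq n).1.1 * f (seq (n + 1 + 1)).1.1 < 0
    rw [h1, hseq]
    exact hneg _

/-- If `x` is a null vector and the neighbour sums of `y` vanish on the support of `x`, then no edge
joins the supports of `x` and `y`. -/
lemma mul_eq_zero_of_mulVec (hb : IsBipartite G) (hc : C4kFree G) {x y : V → ℝ}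
    (hx : (G.adjMatrix ℝ).mulVec x = 0)
    (hy : ∀ v, x v ≠ 0 → (G.adjMatrix ℝ).mulVec y v = 0) {u v : V} (huv : G.Adj u v) :
    y u * x v = 0 := by
  have hb' := hb
  obtain ⟨s, hs⟩ := hb'
  wlog hu : u ∈ s generalizing s
  · refine this sᶜ (fun a b hab => ?_) hu
    have := hs hab
    simp only [Set.mem_compl_iff]
    tauto
  have hv : v ∉ s := (hs huv).1 hu
  let f : V → ℝ := fun a => if a ∈ s then y a else x a
  have key := mul_eq_zero_of_neighbor_sum_eq_zero hb hc f (fun a ha => ?_) huv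
  · simpa [f, hu, hv] using key
  by_cases has : a ∈ s
  · have hx' := congrFun hx a
    rw [adjMatrix_mulVec_apply] at hx'
    refine Eq.trans ?_ hx'
    refine Finset.sum_congr rfl fun b hb => ?_
    have : b ∉ s := (hs ((G.mem_neighborFinset a b).1 hb)).1 has
    simp [f, this]
  · have hy' := hy a (by simpa [f, has] using ha)
    rw [adjMatrix_mulVec_apply] at hy'
    rw [← hy']
    refine Finset.sum_congr rfl fun b hb => ?_
    have : b ∈ s := (hs ((G.mem_neighborFinset a b).1 hb).symm).2 has
    simp [f, this]

/-- Some null vector is nonzero on the whole support of `G`. -/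
lemma exists_null_vector_support_eq (G : SimpleGraph V) :
    ∃ x : V → ℝ, (G.adjMatrix ℝ).mulVec x = 0 ∧ ∀ v, x v ≠ 0 ↔ v ∈ supp G := by
  have hcov := mt (Subspace.exists_eq_top_of_iUnion_eq_univ (k := ℝ) (E := nullModule G)
    (p := fun v : supp G => LinearMap.ker ((LinearMap.proj (v : V)).domRestrict (nullModule G))))
    (by
      rintro ⟨⟨v, y, hy, hyv⟩, htop⟩
      have : (⟨y, hy⟩ : nullModule G) ∈ LinearMap.ker
        ((LinearMap.proj (R := ℝ) (φ := fun _ : V => ℝ) v).domRestrict (nullModule G)) :=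
          htop ▸ Submodule.mem_top
      exact hyv (by simpa using this))
  obtain ⟨⟨x, hx⟩, hxs⟩ := (Set.ne_univ_iff_exists_notMem _).1 hcov
  simp only [Set.mem_iUnion, not_exists] at hxs
  exact ⟨x, hx, fun v => ⟨fun h => ⟨x, hx, h⟩, fun h h0 => hxs ⟨v, h⟩ (by simpa using h0)⟩⟩

lemma not_adj_of_mem_supp (hb : IsBipartite G) (hc : C4kFree G) {u v : V} (hu : u ∈ supp G)
    (hv : v ∈ supp G) : ¬ G.Adj u v := by
  obtain ⟨x, hx, hxs⟩ := exists_null_vector_support_eq G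
  intro huv
  exact mul_ne_zero ((hxs u).2 hu) ((hxs v).2 hv)
    (mul_eq_zero_of_mulVec hb hc hx (fun v _ => by rw [hx]; rfl) huv)

lemma eq_zero_of_mem_core (hb : IsBipartite G) (hc : C4kFree G) {y : V → ℝ}
    (hy : ∀ v ∈ supp G, (G.adjMatrix ℝ).mulVec y v = 0) {u : V} (hu : u ∈ core G) : y u = 0 := by
  obtain ⟨x, hx, hxs⟩ := exists_null_vector_support_eq G
  obtain ⟨v, hv, huv⟩ := hu
  exact (mul_eq_zero.1 (mul_eq_zero_of_mulVec hb hc hx (fun v h => hy v ((hxs v).1 h)) huv)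
    ).resolve_right ((hxs v).2 hv)

lemma disjoint_supp_core (hb : IsBipartite G) (hc : C4kFree G) : Disjoint (supp G) (core G) :=
  Set.disjoint_left.2 fun _ hu ⟨_, hv, huv⟩ => not_adj_of_mem_supp hb hc hu hv huv

lemma not_adj_npart_supp {u v : V} (hu : u ∈ npart G) (hv : v ∈ supp G) : ¬ G.Adj u v :=
  fun h => hu (Or.inr ⟨v, hv, h⟩)


end NullSpace

section Matrix

lemma submatrix_mulVec_of_support {l m n : Type*} [Fintype n] (M : Matrix m n ℝ) (f : l → m)
    {Q : Set n} {x : n → ℝ} (hx : ∀ v ∉ Q, x v = 0) (i : l) :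
    (M.submatrix f (Subtype.val : Q → n)).mulVec (fun q => x q) i = M.mulVec x (f i) := by
  refine Fintype.sum_of_injective Subtype.val Subtype.val_injective _ _ (fun v hv => ?_)
    fun _ => rfl
  rw [hx v (by simpa using hv), mul_zero]

lemma mulVec_submatrix_injective {m n : Type*} [Fintype n] {M : Matrix m n ℝ} {P : Set n}
    {Q : Set m} (h : ∀ y : n → ℝ, (∀ v ∉ P, y v = 0) → (∀ v ∈ Q, M.mulVec y v = 0) → y = 0) :
    Function.Injective
      (M.submatrix (Subtype.val : Q → m) (Subtype.val : P → n)).mulVecLin := by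
  rw [← LinearMap.ker_eq_bot, LinearMap.ker_eq_bot']
  intro z hz
  let y : n → ℝ := fun v => if hv : v ∈ P then z ⟨v, hv⟩ else 0
  have hyP : ∀ v ∉ P, y v = 0 := fun v hv => dif_neg hv
  have hyz : (fun p : P => y p) = z := funext fun p => dif_pos p.2
  have hy : y = 0 := h y hyP fun v hv => by
    rw [← submatrix_mulVec_of_support M (Subtype.val : Q → m) hyP ⟨v, hv⟩, hyz]
    exact congrFun hz ⟨v, hv⟩
  rw [← hyz, hy]
  rfl

/-- A matrix with trivial kernel has a nonzero entry in every column, in pairwise distinct rows. -/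
lemma exists_injective_ne_zero_of_mulVec_injective {m n : Type*} [Fintype m] [Fintype n]
    {M : Matrix m n ℝ} (hM : Function.Injective M.mulVecLin) :
    ∃ g : n → m, Function.Injective g ∧ ∀ j, M (g j) j ≠ 0 := by
  obtain ⟨g, hg, hgt⟩ := (Finset.all_card_le_biUnion_card_iff_exists_injective
    (fun j : n => Finset.univ.filter fun i => M i j ≠ 0)).1 (fun X => by
      set Y := X.biUnion fun j => Finset.univ.filter fun i => M i j ≠ 0
      have hinj := mulVec_submatrix_injective (M := M) (P := (X : Set n)) (Q := (Y : Set m))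
        (fun y hy hyY => hM (by
          rw [map_zero]
          ext i
          by_cases hi : i ∈ Y
          · exact hyY i hi
          · refine Finset.sum_eq_zero fun j _ => ?_
            by_cases hj : j ∈ X
            · have : M i j = 0 := by
                by_contra hij
                exact hi (Finset.mem_biUnion.2 ⟨j, hj, by simpa using hij⟩)
              exact mul_eq_zero_of_left this _
            · exact mul_eq_zero_of_right _ (hy j (by simpa using hj))))
      simpa using LinearMap.finrank_le_finrank_of_injective hinj)
  exact ⟨g, hg, fun j => by simpa using hgt j⟩

end Matrix

section Counting

omit [DecidableEq V]

variable {G : SimpleGraph V}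

lemma exists_injOn_adj {P Q : Set V} (h : ∀ y : V → ℝ, (∀ v ∉ P, y v = 0) →
    (∀ v ∈ Q, (G.adjMatrix ℝ).mulVec y v = 0) → y = 0) :
    ∃ g : V → V, Set.InjOn g P ∧ Set.MapsTo g P Q ∧ ∀ v ∈ P, G.Adj v (g v) := by
  obtain ⟨g, hg, hne⟩ := exists_injective_ne_zero_of_mulVec_injective
    (mulVec_submatrix_injective h)
  let e : V → V := fun v => if hv : v ∈ P then g ⟨v, hv⟩ else v
  have he : ∀ v (hv : v ∈ P), e v = g ⟨v, hv⟩ := fun v hv => dif_pos hv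
  refine ⟨e, fun a ha b hb hab => ?_, fun a ha => ?_, fun a ha => ?_⟩
  · rw [he a ha, he b hb] at hab
    exact congrArg Subtype.val (hg (Subtype.ext hab))
  · rw [he a ha]
    exact (g _).2
  · rw [he a ha]
    have := hne ⟨a, ha⟩
    rw [Matrix.submatrix_apply, adjMatrix_apply] at this
    exact (by simpa using this : G.Adj _ _).symm

lemma eq_zero_of_support_subset_core (hb : IsBipartite G) (hc : C4kFree G) {y : V → ℝ}
    (hy : ∀ v ∉ core G, y v = 0) (hA : ∀ v ∈ supp G, (G.adjMatrix ℝ).mulVec y v = 0) : y = 0 := by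
  ext v
  by_cases hv : v ∈ core G
  · exact eq_zero_of_mem_core hb hc hA hv
  · exact hy v hv

lemma mulVec_eq_zero_of_not_mem_core {z : V → ℝ} (hz : ∀ v ∉ supp G, z v = 0) {u : V}
    (hu : u ∉ core G) : (G.adjMatrix ℝ).mulVec z u = 0 := by
  rw [adjMatrix_mulVec_apply]
  refine Finset.sum_eq_zero fun v hv => hz v fun hvs => hu ⟨v, hvs, ?_⟩
  exact (G.mem_neighborFinset u v).1 hv

lemma rank_core_supp (hb : IsBipartite G) (hc : C4kFree G) :
    ((G.adjMatrix ℝ).submatrix (Subtype.val : core G → V) (Subtype.val : supp G → V)).rank =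
      (core G).ncard := by
  have hinj := mulVec_submatrix_injective (M := G.adjMatrix ℝ) (P := core G) (Q := supp G)
    fun y hy hA => eq_zero_of_support_subset_core hb hc hy hA
  have hT : (G.adjMatrix ℝ).submatrix (Subtype.val : core G → V) (Subtype.val : supp G → V) =
      ((G.adjMatrix ℝ).submatrix (Subtype.val : supp G → V)
        (Subtype.val : core G → V)).transpose := by
    rw [Matrix.transpose_submatrix, transpose_adjMatrix]
  rw [hT, Matrix.rank_transpose, Matrix.rank, LinearMap.finrank_range_of_inj hinj]
  simp [Set.ncard_eq_toFinset_card']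

lemma exists_mulVec_eq_on_core (hb : IsBipartite G) (hc : C4kFree G) (w : V → ℝ) :
    ∃ z : V → ℝ, (∀ v ∉ supp G, z v = 0) ∧
      ∀ u ∈ core G, (G.adjMatrix ℝ).mulVec z u = w u := by
  have hr := rank_core_supp hb hc
  have htop : LinearMap.range ((G.adjMatrix ℝ).submatrix (Subtype.val : core G → V)
      (Subtype.val : supp G → V)).mulVecLin = ⊤ := by
    apply Submodule.eq_top_of_finrank_eq
    rw [← Matrix.rank, hr]
    simp [Set.ncard_eq_toFinset_card']
  obtain ⟨z, hz⟩ := LinearMap.range_eq_top.1 htop fun u => w u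
  let y : V → ℝ := fun v => if hv : v ∈ supp G then z ⟨v, hv⟩ else 0
  have hyP : ∀ v ∉ supp G, y v = 0 := fun v hv => dif_neg hv
  have hyz : (fun p : supp G => y p) = z := funext fun p => dif_pos p.2
  refine ⟨y, hyP, fun u hu => ?_⟩
  rw [← submatrix_mulVec_of_support (G.adjMatrix ℝ) (Subtype.val : core G → V) hyP ⟨u, hu⟩, hyz]
  exact congrFun hz ⟨u, hu⟩

lemma eq_zero_of_mem_nullModule {x : V → ℝ} (hx : x ∈ nullModule G) :
    ∀ v ∉ supp G, x v = 0 := fun v hv => by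
  by_contra h
  exact hv ⟨x, hx, h⟩

lemma nullity_add_ncard_core (hb : IsBipartite G) (hc : C4kFree G) :
    nullity G + (core G).ncard = (supp G).ncard := by
  set T := ((G.adjMatrix ℝ).submatrix (Subtype.val : core G → V) (Subtype.val : supp G → V))
    with hT
  have hr := T.mulVecLin.finrank_range_add_finrank_ker
  rw [← Matrix.rank, hT, rank_core_supp hb hc, ← hT] at hr
  have hres : ∀ x ∈ nullModule G, LinearMap.funLeft ℝ ℝ (Subtype.val : supp G → V) x ∈
      LinearMap.ker T.mulVecLin := fun x hx => by
    ext u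
    exact (submatrix_mulVec_of_support _ _ (eq_zero_of_mem_nullModule hx) u).trans
      (congrFun hx u.1)
  let L := (LinearMap.funLeft ℝ ℝ (Subtype.val : supp G → V)).restrict hres
  have hbij : Function.Bijective L := by
    constructor
    · rintro ⟨x, hx⟩ ⟨y, hy⟩ hxy
      ext v
      by_cases hv : v ∈ supp G
      · exact congrFun (congrArg Subtype.val hxy) ⟨v, hv⟩
      · exact (eq_zero_of_mem_nullModule hx v hv).trans (eq_zero_of_mem_nullModule hy v hv).symm
    · rintro ⟨z, hz⟩
      let y : V → ℝ := fun v => if hv : v ∈ supp G then z ⟨v, hv⟩ else 0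
      have hyP : ∀ v ∉ supp G, y v = 0 := fun v hv => dif_neg hv
      have hyz : (fun p : supp G => y p) = z := funext fun p => dif_pos p.2
      refine ⟨⟨y, ?_⟩, Subtype.ext hyz⟩
      change (G.adjMatrix ℝ).mulVec y = 0
      ext u
      by_cases hu : u ∈ core G
      · rw [← submatrix_mulVec_of_support (G.adjMatrix ℝ) (Subtype.val : core G → V) hyP ⟨u, hu⟩,
          hyz]
        exact congrFun hz ⟨u, hu⟩
      · exact mulVec_eq_zero_of_not_mem_core hyP hu
  rw [← (LinearEquiv.ofBijective L hbij).finrank_eq] at hr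
  rw [nullity, add_comm, hr]
  simp [Set.ncard_eq_toFinset_card']

lemma eq_zero_of_support_subset_npart (hb : IsBipartite G) (hc : C4kFree G) {y : V → ℝ}
    (hy : ∀ v ∉ npart G, y v = 0) (hA : ∀ v ∈ npart G, (G.adjMatrix ℝ).mulVec y v = 0) :
    y = 0 := by
  obtain ⟨z, hz, hzA⟩ := exists_mulVec_eq_on_core hb hc ((G.adjMatrix ℝ).mulVec y)
  have hnull : (G.adjMatrix ℝ).mulVec (y - z) = 0 := by
    ext u
    rw [Matrix.mulVec_sub, Pi.sub_apply]
    by_cases hu : u ∈ core G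
    · rw [hzA u hu, sub_self]; rfl
    rw [mulVec_eq_zero_of_not_mem_core hz hu, sub_zero]
    by_cases hus : u ∈ supp G
    · rw [adjMatrix_mulVec_apply]
      refine Finset.sum_eq_zero fun v hv => hy v fun hvn => not_adj_npart_supp hvn hus ?_
      exact ((G.mem_neighborFinset u v).1 hv).symm
    · exact hA u (by simp [npart, hu, hus])
  ext v
  by_cases hv : v ∈ npart G
  · have hvs : v ∉ supp G := fun h => hv (Or.inl h)
    simpa [hz v hvs] using eq_zero_of_mem_nullModule (x := y - z) hnull v hvs
  · exact hy v hv

lemma ncard_supp_add_ncard_core_add_ncard_npart (hb : IsBipartite G) (hc : C4kFree G) :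
    (supp G).ncard + (core G).ncard + (npart G).ncard = Fintype.card V := by
  rw [← Set.ncard_union_eq (disjoint_supp_core hb hc), npart, Set.ncard_add_ncard_compl,
    Nat.card_eq_fintype_card]

/-- An independent set misses an endpoint of every edge of a matching. -/
lemma ncard_edgeSet_add_ncard_le {M : G.Subgraph} (hM : M.IsMatching) {t : Set V}
    (ht : IsIndep G t) : M.edgeSet.ncard + t.ncard ≤ Fintype.card V := by
  have hex : ∀ e, ∃ v, e ∈ M.edgeSet → v ∉ t ∧ v ∈ e := by
    intro e
    induction e with
    | h a b =>
      by_cases ha : a ∈ t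
      · exact ⟨b, fun hab => ⟨fun hb => ht ha hb (M.adj_sub hab), by simp⟩⟩
      · exact ⟨a, fun _ => ⟨ha, by simp⟩⟩
  choose p hp using hex
  have hinj : Set.InjOn p M.edgeSet := by
    intro e he e' he' h
    have h1 := (hp e he).2
    have h2 := h ▸ (hp e' he').2
    obtain ⟨a, ha⟩ := h1
    obtain ⟨b, hb⟩ := h2
    rw [ha] at he
    rw [hb] at he'
    have hab : a = b := hM.eq_of_adj_left he he'
    rw [ha, hb, hab]
  have hle : M.edgeSet.ncard ≤ tᶜ.ncard := Set.ncard_le_ncard_of_injOn p (fun e he => (hp e he).1) hinj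
  have := Set.ncard_add_ncard_compl t
  rw [Nat.card_eq_fintype_card] at this
  omega

omit [Fintype V] in
/-- An injection `g` along edges from `D` to the complement of `D` gives a matching with
`|D|` edges. -/
lemma exists_isMatching_of_injOn {D : Set V} {g : V → V} (hg : Set.InjOn g D)
    (hadj : ∀ v ∈ D, G.Adj v (g v)) (hD : ∀ v ∈ D, g v ∉ D) :
    ∃ M : G.Subgraph, M.IsMatching ∧ M.edgeSet.ncard = D.ncard := by
  let M : G.Subgraph :=
    { verts := D ∪ g '' D
      Adj := fun a b => (a ∈ D ∧ g a = b) ∨ (b ∈ D ∧ g b = a)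
      adj_sub := by
        rintro a b (⟨ha, rfl⟩ | ⟨hb, rfl⟩)
        · exact hadj a ha
        · exact (hadj b hb).symm
      edge_vert := by
        rintro a b (⟨ha, rfl⟩ | ⟨hb, rfl⟩)
        · exact Or.inl ha
        · exact Or.inr ⟨b, hb, rfl⟩
      symm := ⟨fun a b h => h.symm⟩ }
  refine ⟨M, ?_, ?_⟩
  · rintro a (ha | ⟨b, hb, rfl⟩)
    · refine ⟨g a, Or.inl ⟨ha, rfl⟩, ?_⟩
      rintro c (⟨-, rfl⟩ | ⟨hc, rfl⟩)
      · rfl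
      · exact absurd ha (hD c hc)
    · refine ⟨b, Or.inr ⟨hb, rfl⟩, ?_⟩
      rintro c (⟨hc, -⟩ | ⟨hc, h⟩)
      · exact absurd hc (hD b hb)
      · exact hg hc hb h
  · symm
    refine Set.ncard_congr (fun v _ => s(v, g v)) (fun v hv => Or.inl ⟨hv, rfl⟩) ?_ ?_
    · intro a b ha hb h
      rcases Sym2.eq_iff.1 h with ⟨h, -⟩ | ⟨h, -⟩
      · exact h
      · exact absurd (h ▸ ha) (hD b hb)
    · intro e
      induction e with
      | h a b =>
        rintro (⟨ha, h⟩ | ⟨hb, h⟩)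
        · exact ⟨a, ha, congrArg (fun c => s(a, c)) h⟩
        · exact ⟨b, hb, (congrArg (fun c => s(b, c)) h).trans Sym2.eq_swap⟩

lemma exists_isMatching_and_isIndep (hb : IsBipartite G) (hc : C4kFree G) :
    ∃ k, (npart G).ncard = 2 * k ∧
      (∃ M : G.Subgraph, M.IsMatching ∧ M.edgeSet.ncard = (core G).ncard + k) ∧
      ∃ t : Set V, IsIndep G t ∧ t.ncard = (supp G).ncard + k := by
  obtain ⟨g, hg, hgS, hgadj⟩ := exists_injOn_adj (P := core G) (Q := supp G)
    fun y hy hA => eq_zero_of_support_subset_core hb hc hy hA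
  obtain ⟨f, hf, hfN, hfadj⟩ := exists_injOn_adj (P := npart G) (Q := npart G)
    fun y hy hA => eq_zero_of_support_subset_npart hb hc hy hA
  have hSC := disjoint_supp_core hb hc
  have hSN : Disjoint (supp G) (npart G) := Set.disjoint_left.2 fun v h h' => h' (Or.inl h)
  have hCN : Disjoint (core G) (npart G) := Set.disjoint_left.2 fun v h h' => h' (Or.inr h)
  have hSS := fun u hu v hv => not_adj_of_mem_supp (u := u) (v := v) hb hc hu hv
  obtain ⟨s, hs⟩ := hb
  have h1 : (npart G ∩ s).ncard ≤ (npart G \ s).ncard :=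
    Set.ncard_le_ncard_of_injOn f
      (fun v hv => ⟨hfN hv.1, (hs (hfadj v hv.1)).1 hv.2⟩) (hf.mono Set.inter_subset_left)
  have h2 : (npart G \ s).ncard ≤ (npart G ∩ s).ncard :=
    Set.ncard_le_ncard_of_injOn f
      (fun v hv => ⟨hfN hv.1, (hs (hfadj v hv.1).symm).2 hv.2⟩) (hf.mono Set.sdiff_subset)
  have h3 := Set.ncard_inter_add_ncard_sdiff_eq_ncard (npart G) s
  refine ⟨(npart G ∩ s).ncard, by omega, ?_, supp G ∪ npart G ∩ s, ?_, ?_⟩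
  · rw [← Set.ncard_union_eq (hCN.mono_right Set.inter_subset_left)]
    have hN : ∀ {v}, v ∈ npart G → v ∉ core G := fun h h' => Set.disjoint_left.1 hCN h' h
    have hS : ∀ {v}, v ∈ supp G → v ∉ core G ∧ v ∉ npart G := fun h =>
      ⟨Set.disjoint_left.1 hSC h, Set.disjoint_left.1 hSN h⟩
    apply exists_isMatching_of_injOn (g := fun v => if v ∈ core G then g v else f v)
    · rintro a (ha | ha) b (hb | hb) h
      · simp only [ha, hb, if_true] at h
        exact hg ha hb h
      · simp only [ha, hN hb.1, if_true, if_false] at h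
        exact absurd (h ▸ hfN hb.1) (hS (hgS ha)).2
      · simp only [hb, hN ha.1, if_true, if_false] at h
        exact absurd (h ▸ hfN ha.1) (hS (hgS hb)).2
      · simp only [hN ha.1, hN hb.1, if_false] at h
        exact hf ha.1 hb.1 h
    · rintro a (ha | ha)
      · simpa only [ha, if_true] using hgadj a ha
      · simpa only [hN ha.1, if_false] using hfadj a ha.1
    · rintro a (ha | ha)
      · simp only [ha, if_true]
        rintro (h | h)
        · exact (hS (hgS ha)).1 h
        · exact (hS (hgS ha)).2 h.1
      · simp only [hN ha.1, if_false]
        rintro (h | h)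
        · exact hN (hfN ha.1) h
        · exact (hs (hfadj a ha.1)).1 ha.2 h.2
  · rintro a (ha | ha) b (hb | hb) hab
    · exact hSS a ha b hb hab
    · exact not_adj_npart_supp hb.1 ha hab.symm
    · exact not_adj_npart_supp ha.1 hb hab
    · exact (hs hab).1 ha.2 hb.2
  · exact Set.ncard_union_eq (hSN.mono_right Set.inter_subset_left)

lemma rk_add_nullity (G : SimpleGraph V) : rk G + nullity G = Fintype.card V := by
  have := (G.adjMatrix ℝ).mulVecLin.finrank_range_add_finrank_ker
  rwa [Module.finrank_fintype_fun_eq_card] at this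

end Counting

/-- counting formulas for the matching number, independence number,
nullity and rank of a `C_{4k}`-free bipartite graph. -/
theorem stmt19 (G : SimpleGraph V) (hb : IsBipartite G) (hc : C4kFree G) :
    (matchNum G : ℚ) = (core G).ncard + (npart G).ncard / 2 ∧
    (indepNum G : ℚ) = (supp G).ncard + (npart G).ncard / 2 ∧
    (nullity G : ℤ) = (supp G).ncard - (core G).ncard ∧
    rk G = 2 * (core G).ncard + (npart G).ncard := by
  obtain ⟨k, hk, ⟨M, hM, hMcard⟩, t, ht, htcard⟩ := exists_isMatching_and_isIndep hb hc
  have hnull := nullity_add_ncard_core hb hc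
  have htotal := ncard_supp_add_ncard_core_add_ncard_npart hb hc
  have hrk := rk_add_nullity G
  have hmatch : matchNum G = (core G).ncard + k := by
    refine IsGreatest.csSup_eq ⟨⟨M, hM, hMcard⟩, ?_⟩
    rintro n ⟨M', hM', rfl⟩
    have := ncard_edgeSet_add_ncard_le hM' ht
    omega
  have hindep : indepNum G = (supp G).ncard + k := by
    refine IsGreatest.csSup_eq ⟨⟨t, ht, htcard⟩, ?_⟩
    rintro n ⟨t', ht', rfl⟩
    have := ncard_edgeSet_add_ncard_le hM ht'
    omega
  refine ⟨?_, ?_, by omega, by omega⟩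
  · rw [hmatch, hk]
    push_cast
    ring
  · rw [hindep, hk]
    push_cast
    ring

end C4kPaper
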